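/- arXiv:1812.00309 — 3 statements merged into one kernel-verified Lean document; each statement's English description precedes it below -/
import Mathlib

section
/- Two-line sorting preserves single-path last passage values: Let f₁, f₂ : [0,∞) → ℝ be continuous and set f = (f₁,f₂). Define G(x,y) = max_{s ∈ [x,y]} (f₂(s) − f₁(s)), and define W(f₁,f₂) = (W₁,W₂) by W₁(t) = f₁(t) − f₂(0) + G(0,t) and W₂(t) = f₂(t) − f₁(0) − G(0,t). Then for every 0 ≤ x < y, f[(x,2)→(y,1)] = W(f₁,f₂)[(x,2)→(y,1)]; explicitly, sup_{t ∈ [x,y]} ( f₂(t) − f₂(x) + f₁(y) − f₁(t) ) = sup_{t ∈ [x,y]} ( W₂(t) − W₂(x) + W₁(y) − W₁(t) ). -/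
/-- The maximal gap size `G(f₁,f₂)(x,y) = max_{s ∈ [x,y]} (f₂(s) − f₁(s))`. -/
noncomputable def maxGap (f₁ f₂ : ℝ → ℝ) (x y : ℝ) : ℝ :=
  sSup ((fun s => f₂ s - f₁ s) '' Set.Icc x y)

/-- The top line of the sorted pair `W(f₁,f₂)`. -/
noncomputable def W1 (f₁ f₂ : ℝ → ℝ) (t : ℝ) : ℝ :=
  f₁ t - f₂ 0 + maxGap f₁ f₂ 0 t

/-- The bottom line of the sorted pair `W(f₁,f₂)`. -/
noncomputable def W2 (f₁ f₂ : ℝ → ℝ) (t : ℝ) : ℝ :=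
  f₂ t - f₁ 0 - maxGap f₁ f₂ 0 t

open Set

theorem isGreatest_maxGap {f₁ f₂ : ℝ → ℝ} (h₁ : ContinuousOn f₁ (Ici 0))
    (h₂ : ContinuousOn f₂ (Ici 0)) {x y : ℝ} (hx : 0 ≤ x) (hxy : x ≤ y) :
    IsGreatest ((fun s => f₂ s - f₁ s) '' Icc x y) (maxGap f₁ f₂ x y) := by
  have hsub : Icc x y ⊆ Ici 0 := fun t ht => hx.trans ht.1
  exact (isCompact_Icc.image_of_continuousOn ((h₂.sub h₁).mono hsub)).isGreatest_sSup
    ((nonempty_Icc.2 hxy).image _)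

/-- A continuous function that starts at or below a level and ends at or above it attains the
level at a first time. -/
theorem exists_first_hitting_time {d : ℝ → ℝ} {x y m : ℝ} (hxy : x ≤ y)
    (hd : ContinuousOn d (Icc x y)) (hdx : d x ≤ m) (hdy : m ≤ d y) :
    ∃ t ∈ Icc x y, d t = m ∧ ∀ s ∈ Icc x t, d s ≤ m := by
  have hcomp : IsCompact (Icc x y ∩ d ⁻¹' Ici m) :=
    isCompact_Icc.of_isClosed_subset (hd.preimage_isClosed_of_isClosed isClosed_Icc isClosed_Ici)
      inter_subset_left
  obtain ⟨t, ⟨ht, htm⟩, hmin⟩ := hcomp.exists_isLeast ⟨y, right_mem_Icc.2 hxy, hdy⟩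
  obtain ⟨r, hr, hrm⟩ :=
    intermediate_value_Icc ht.1 (hd.mono (Icc_subset_Icc_right ht.2)) ⟨hdx, htm⟩
  have hrt : r = t := le_antisymm hr.2 (hmin ⟨⟨hr.1, hr.2.trans ht.2⟩, hrm.ge⟩)
  subst hrt
  refine ⟨r, ht, hrm, fun s hs => ?_⟩
  by_contra! hlt
  have hrs : r ≤ s := hmin ⟨⟨hs.1, hs.2.trans ht.2⟩, hlt.le⟩
  rw [le_antisymm hs.2 hrs, hrm] at hlt
  exact lt_irrefl _ hlt


/-- **Two-line sorting preserves single-path last passage values.** For continuous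
`f₁, f₂` on `[0, ∞)` and `0 ≤ x < y`, the two-line last passage value from `(x, 2)`
to `(y, 1)` is the same for `(f₁, f₂)` and for the sorted pair `W(f₁, f₂)`. -/
theorem two_line_sorting
    (f₁ f₂ : ℝ → ℝ)
    (h₁ : ContinuousOn f₁ (Set.Ici 0)) (h₂ : ContinuousOn f₂ (Set.Ici 0))
    (x y : ℝ) (hx : 0 ≤ x) (hxy : x < y) :
    sSup ((fun t => f₂ t - f₂ x + f₁ y - f₁ t) '' Set.Icc x y) =
      sSup ((fun t => W2 f₁ f₂ t - W2 f₁ f₂ x + W1 f₁ f₂ y - W1 f₁ f₂ t) '' Set.Icc x y) := by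
  have hG : ∀ t, 0 ≤ t → IsGreatest ((fun s => f₂ s - f₁ s) '' Icc 0 t) (maxGap f₁ f₂ 0 t) :=
    fun t ht => isGreatest_maxGap h₁ h₂ le_rfl ht
  have hle : ∀ s t, 0 ≤ s → s ≤ t → f₂ s - f₁ s ≤ maxGap f₁ f₂ 0 t := fun s t hs hst =>
    (hG t (hs.trans hst)).2 ⟨s, ⟨hs, hst⟩, rfl⟩
  have hmono : ∀ s t, 0 ≤ s → s ≤ t → maxGap f₁ f₂ 0 s ≤ maxGap f₁ f₂ 0 t := by
    intro s t hs hst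
    obtain ⟨r, hr, hrs⟩ := (hG s hs).1
    rw [← hrs]
    exact hle r t hr.1 (hr.2.trans hst)
  have hbound : ∀ m t, x ≤ t → maxGap f₁ f₂ 0 x ≤ m → (∀ s ∈ Icc x t, f₂ s - f₁ s ≤ m) →
      maxGap f₁ f₂ 0 t ≤ m := by
    intro m t ht hm hs
    obtain ⟨r, hr, hrt⟩ := (hG t (hx.trans ht)).1
    rw [← hrt]
    rcases le_total r x with h | h
    · exact (hle r x hr.1 h).trans hm
    · exact hs r ⟨h, hr.2⟩
  obtain ⟨⟨p, hp, hpL⟩, hmax⟩ := isGreatest_maxGap h₁ h₂ hx hxy.le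
  have hpmax : ∀ t ∈ Icc x y, f₂ t - f₁ t ≤ f₂ p - f₁ p := fun t ht => by
    simpa only [← hpL] using hmax ⟨t, ht, rfl⟩
  have hleft : IsGreatest ((fun t => f₂ t - f₂ x + f₁ y - f₁ t) '' Icc x y)
      (f₂ p - f₂ x + f₁ y - f₁ p) := by
    refine ⟨⟨p, hp, rfl⟩, ?_⟩
    rintro _ ⟨t, ht, rfl⟩
    linarith [hpmax t ht]
  rw [hleft.csSup_eq]
  refine (IsGreatest.csSup_eq ?_).symm
  simp only [W1, W2]
  rcases le_total (f₂ p - f₁ p) (maxGap f₁ f₂ 0 x) with hcase | hcase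
  · have hconst : ∀ t ∈ Icc x y, maxGap f₁ f₂ 0 t = maxGap f₁ f₂ 0 x := fun t ht =>
      le_antisymm
        (hbound _ t ht.1 le_rfl fun s hs => (hpmax s ⟨hs.1, hs.2.trans ht.2⟩).trans hcase)
        (hmono x t hx ht.1)
    have hy := hconst y (right_mem_Icc.2 hxy.le)
    refine ⟨⟨p, hp, ?_⟩, ?_⟩
    · linarith [hconst p hp]
    · rintro _ ⟨t, ht, rfl⟩
      linarith [hconst t ht, hpmax t ht]
  · have hy : maxGap f₁ f₂ 0 y = f₂ p - f₁ p :=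
      le_antisymm (hbound _ y hxy.le hcase hpmax) (hle p y (hx.trans hp.1) hp.2)
    have hcont : ContinuousOn (fun s => f₂ s - f₁ s) (Icc x p) :=
      (h₂.sub h₁).mono fun t ht => hx.trans ht.1
    obtain ⟨t, ht, htx, hts⟩ := exists_first_hitting_time hp.1 hcont (hle x x hx le_rfl) hcase
    have hMt : maxGap f₁ f₂ 0 t = maxGap f₁ f₂ 0 x :=
      le_antisymm (hbound _ t ht.1 le_rfl hts) (hmono x t hx ht.1)
    refine ⟨⟨t, ⟨ht.1, ht.2.trans hp.2⟩, ?_⟩, ?_⟩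
    · linarith
    · rintro _ ⟨s, hs, rfl⟩
      linarith [hle s s (hx.trans hs.1) le_rfl, hmono x s hx hs.1]
end

section
/- A deterministic inequality for rescaled melon sums: Let b > 0 be fixed. Then there exists a constant c > 0 such that for all integers n ≥ 2, all t ∈ {1/n, 2/n, …, (n−1)/n}, all r > 1, and all z ∈ [0,1] with |z − t| ≥ c (min(t, 1−t))^{1/3} r² n^{−1/3}, the following holds: 2(√(n t z) + √(n(1−t)(1−z))) + r(√z (n t)^{−1/6} + √(1−z) (n(1−t))^{−1/6}) + √z (n t)^{−1/6} b log^{2/3}( (n t)^{1/3} log( max(t/z, z/t) ) + 1 ) + √(1−z) (n(1−t))^{−1/6} b log^{2/3}( (n(1−t))^{1/3} log( max((1−t)/(1−z), (1−z)/(1−t)) ) + 1 ) ≤ 2√n − r n^{−1/6}. -/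
open Real in
/-- The logarithmic ratio of `T ^ 6` and `Z ^ 2`, damped by `T * Z`, is controlled by the
distance between the square roots `T ^ 3` and `Z`. -/
theorem mul_log_max_ratio_le {T Z : ℝ} (hT : 0 < T) (hT1 : T ≤ 1) (hZ : 0 ≤ Z) (hZ1 : Z ≤ 1) :
    T * Z * log (max (T ^ 6 / Z ^ 2) (Z ^ 2 / T ^ 6)) ≤ 8 * |T ^ 3 - Z| := by
  rcases hZ.eq_or_lt with rfl | hZ
  · simp
  have hT3 : 0 < T ^ 3 := by positivity
  rcases le_total Z (T ^ 3) with h | h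
  · have hmax : max (T ^ 6 / Z ^ 2) (Z ^ 2 / T ^ 6) = (T ^ 3 / Z) ^ 2 := by
      rw [max_eq_left]
      · ring
      · have h2 : Z ^ 2 ≤ T ^ 6 := by nlinarith
        rw [div_le_div_iff₀ (by positivity) (by positivity)]
        exact mul_self_le_mul_self (by positivity) h2 |>.trans_eq' (by ring) |>.trans_eq (by ring)
    rw [hmax, log_pow, abs_of_nonneg (sub_nonneg.2 h)]
    have hlog : log (T ^ 3 / Z) ≤ T ^ 3 / Z - 1 := log_le_sub_one_of_pos (by positivity)
    have hZlog : Z * log (T ^ 3 / Z) ≤ T ^ 3 - Z := by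
      calc Z * log (T ^ 3 / Z) ≤ Z * (T ^ 3 / Z - 1) := by gcongr
        _ = T ^ 3 - Z := by field_simp
    push_cast
    nlinarith [mul_le_mul_of_nonneg_left hZlog hT.le,
      mul_le_mul_of_nonneg_right hT1 (sub_nonneg.2 h)]
  · have hmax : max (T ^ 6 / Z ^ 2) (Z ^ 2 / T ^ 6) = (Z / T ^ 3) ^ 2 := by
      rw [max_eq_right]
      · ring
      · have h2 : T ^ 6 ≤ Z ^ 2 := by nlinarith
        rw [div_le_div_iff₀ (by positivity) (by positivity)]
        exact mul_self_le_mul_self (by positivity) h2 |>.trans_eq' (by ring) |>.trans_eq (by ring)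
    rw [hmax, log_pow, abs_of_nonpos (sub_nonpos.2 h)]
    have hlog : log (Z / T ^ 3) ≤ Z / T ^ 3 - 1 := log_le_sub_one_of_pos (by positivity)
    have hlog0 : 0 ≤ log (Z / T ^ 3) := log_nonneg ((one_le_div hT3).2 h)
    have hnear : T ^ 3 * log (Z / T ^ 3) ≤ Z - T ^ 3 := by
      calc T ^ 3 * log (Z / T ^ 3) ≤ T ^ 3 * (Z / T ^ 3 - 1) := by gcongr
        _ = Z - T ^ 3 := by field_simp
    have hfar : T * log (Z / T ^ 3) ≤ 3 := by
      have h1 : log (Z / T ^ 3) ≤ 3 * log (1 / T) := by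
        calc log (Z / T ^ 3) ≤ log ((1 / T) ^ 3) := by
              apply log_le_log (by positivity)
              rw [div_pow, one_pow]
              gcongr
          _ = 3 * log (1 / T) := by rw [log_pow]; norm_num
      have h2 : log (1 / T) ≤ 1 / T - 1 := log_le_sub_one_of_pos (by positivity)
      calc T * log (Z / T ^ 3) ≤ T * (3 * (1 / T - 1)) := by gcongr; linarith
        _ = 3 * (1 - T) := by field_simp
        _ ≤ 3 := by linarith
    push_cast
    nlinarith [mul_le_mul_of_nonneg_left hnear hT.le,
      mul_le_mul_of_nonneg_right hT1 (sub_nonneg.2 h),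
      mul_le_mul_of_nonneg_right hfar (sub_nonneg.2 h)]

theorem Real.log_add_one_rpow_two_thirds_le {y : ℝ} (hy : 0 ≤ y) :
    Real.log (y + 1) ^ ((2 : ℝ) / 3) ≤ 1 + y := by
  have hlog : Real.log (y + 1) ≤ y := by
    linarith [Real.log_le_sub_one_of_pos (show 0 < y + 1 by linarith)]
  calc Real.log (y + 1) ^ ((2 : ℝ) / 3) ≤ (1 + y) ^ ((2 : ℝ) / 3) := by
        apply Real.rpow_le_rpow (Real.log_nonneg (by linarith)) (by linarith) (by norm_num)
    _ ≤ (1 + y) ^ (1 : ℝ) := Real.rpow_le_rpow_of_exponent_le (by linarith) (by norm_num)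
    _ = 1 + y := Real.rpow_one _

theorem div_le_one_add_dist {N T Z : ℝ} (hT : 0 < T) (hT1 : T ≤ 1) (hN : 1 ≤ N)
    (hNT : 1 ≤ N * T) : Z / T ≤ 1 + N ^ 2 * |T ^ 3 - Z| := by
  have hZ : Z ≤ T ^ 3 + |T ^ 3 - Z| := by linarith [neg_abs_le (T ^ 3 - Z)]
  have hT3 : T ^ 3 ≤ T := by nlinarith [mul_pos hT hT]
  have hNNT : 1 ≤ N ^ 2 * T := by nlinarith
  rw [div_le_iff₀ hT]
  nlinarith [mul_le_mul_of_nonneg_right hNNT (abs_nonneg (T ^ 3 - Z))]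

theorem div_mul_log_rpow_le {N T Z : ℝ} (hT : 0 < T) (hT1 : T ≤ 1) (hN : 1 ≤ N)
    (hNT : 1 ≤ N * T) (hZ : 0 ≤ Z) (hZ1 : Z ≤ 1) :
    Z / T * Real.log ((N * T) ^ 2 *
        Real.log (max (T ^ 6 / Z ^ 2) (Z ^ 2 / T ^ 6)) + 1) ^ ((2 : ℝ) / 3)
      ≤ 1 + 9 * (N ^ 2 * |T ^ 3 - Z|) := by
  rcases hZ.eq_or_lt with rfl | hZ
  · rw [zero_div, zero_mul]
    positivity
  have hmul := mul_log_max_ratio_le hT hT1 hZ.le hZ1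
  set l := Real.log (max (T ^ 6 / Z ^ 2) (Z ^ 2 / T ^ 6)) with hl
  have hl0 : 0 ≤ l := by
    apply Real.log_nonneg
    rcases le_total (Z ^ 2) (T ^ 6) with h | h
    · exact le_max_of_le_left ((one_le_div (by positivity)).2 h)
    · exact le_max_of_le_right ((one_le_div (by positivity)).2 h)
  calc Z / T * Real.log ((N * T) ^ 2 * l + 1) ^ ((2 : ℝ) / 3)
      ≤ Z / T * (1 + (N * T) ^ 2 * l) := by
        gcongr
        exact Real.log_add_one_rpow_two_thirds_le (by positivity)
    _ = Z / T + N ^ 2 * (T * Z * l) := by field_simp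
    _ ≤ (1 + N ^ 2 * |T ^ 3 - Z|) + N ^ 2 * (8 * |T ^ 3 - Z|) := by
        gcongr
        exact div_le_one_add_dist hT hT1 hN hNT
    _ = 1 + 9 * (N ^ 2 * |T ^ 3 - Z|) := by ring

theorem mul_le_dist_of_sq_mul_le {N T Z r k : ℝ} (hT : 0 < T) (hT1 : T ≤ 1)
    (hNT : 1 ≤ N * T) (hN : 0 < N) (hZ : 0 ≤ Z) (hr : 1 ≤ r)
    (h : (k + 1) ^ 2 * T ^ 2 * r ^ 2 * (N ^ 2)⁻¹ ≤ |Z ^ 2 - T ^ 6|) :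
    k * r ≤ N ^ 2 * |T ^ 3 - Z| := by
  set w := N ^ 2 * |T ^ 3 - Z| with hw
  have hw0 : 0 ≤ w := by positivity
  have habs : |Z ^ 2 - T ^ 6| = |T ^ 3 - Z| * (T ^ 3 + Z) := by
    calc |Z ^ 2 - T ^ 6| = |(T ^ 3 - Z) * (T ^ 3 + Z)| := by
          rw [abs_sub_comm]
          congr 1
          ring
      _ = |T ^ 3 - Z| * (T ^ 3 + Z) := by
          rw [abs_mul, abs_of_nonneg (show 0 ≤ T ^ 3 + Z by positivity)]
  rw [habs, ← div_eq_mul_inv, div_le_iff₀ (by positivity)] at h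
  have hZle : Z ≤ T ^ 3 + |T ^ 3 - Z| := by linarith [neg_abs_le (T ^ 3 - Z)]
  have h1 : (k + 1) ^ 2 * T ^ 2 * r ^ 2 ≤ w * (2 * T ^ 3 + |T ^ 3 - Z|) := by
    calc (k + 1) ^ 2 * T ^ 2 * r ^ 2 ≤ w * (T ^ 3 + Z) := by rw [hw]; linarith
      _ ≤ w * (2 * T ^ 3 + |T ^ 3 - Z|) := mul_le_mul_of_nonneg_left (by linarith) hw0
  have h2 : |T ^ 3 - Z| ≤ T ^ 2 * w := by
    have : 1 ≤ (N * T) ^ 2 := one_le_pow₀ hNT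
    rw [hw]
    nlinarith [mul_le_mul_of_nonneg_right this (abs_nonneg (T ^ 3 - Z))]
  have h3 : 2 * T ^ 3 ≤ T ^ 2 * 2 := by nlinarith [mul_pos hT hT]
  have h4 : T ^ 2 * ((k + 1) * r) ^ 2 ≤ T ^ 2 * (w + 1) ^ 2 := by
    have : w * (2 * T ^ 3 + |T ^ 3 - Z|) ≤ w * (T ^ 2 * 2 + T ^ 2 * w) := by gcongr
    nlinarith [mul_pos hT hT]
  have h5 := le_of_mul_le_mul_left h4 (by positivity)
  have h6 : (k + 1) * r ≤ w + 1 := le_of_sq_le_sq h5 (by positivity)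
  nlinarith

theorem linear_le_sq_add_sq_of_le {b r w v : ℝ} (hb : 0 ≤ b) (hr : 1 ≤ r)
    (hw : (18 * b + 5) * r ≤ w) :
    r * (3 + w + v) + b * (2 + 9 * w + 9 * v) ≤ w ^ 2 + v ^ 2 := by
  have hr0 : 0 < r := by linarith
  have hbr : b ≤ b * r := by nlinarith
  obtain ⟨a, ha⟩ : ∃ a, a = r + 9 * b := ⟨_, rfl⟩
  have ha1 : a ≤ (1 + 9 * b) * r := by rw [ha]; linarith
  have ha0 : 0 < a := by rw [ha]; positivity
  have hwa : 2 * a + 3 * r ≤ w := by linarith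
  have h1 : (2 * a + 3 * r) * (a + 3 * r) ≤ w * (w - a) := by
    apply mul_le_mul hwa (by linarith) (by positivity) (by nlinarith)
  have h2 : 2 * b ≤ a * r := by rw [ha]; nlinarith
  have h3 : 3 * r ≤ 3 * r ^ 2 := by nlinarith
  have h4 : r * (3 + w + v) + b * (2 + 9 * w + 9 * v) = 3 * r + 2 * b + a * w + a * v := by
    rw [ha]; ring
  rw [h4]
  linarith [sq_nonneg (v - a / 2), mul_pos ha0 hr0, sq_nonneg a, sq_nonneg r]

/-- The melon sum inequality in the variables `N = n ^ (1/6)`, `T = t ^ (1/6)`,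
`S = (1 - t) ^ (1/6)`, `Z = √z` and `Y = √(1 - z)`. -/
theorem melon_sum_inequality_of_pow {b r N T S Z Y : ℝ} (hb : 0 < b) (hr : 1 < r) (hN : 1 ≤ N)
    (hT : 0 < T) (hS : 0 < S) (hTS : T ^ 6 + S ^ 6 = 1) (hNT : 1 ≤ N * T) (hNS : 1 ≤ N * S)
    (hZ : 0 ≤ Z) (hY : 0 ≤ Y) (hZY : Z ^ 2 + Y ^ 2 = 1)
    (h : (18 * b + 5 + 1) ^ 2 * min (T ^ 2) (S ^ 2) * r ^ 2 * (N ^ 2)⁻¹ ≤ |Z ^ 2 - T ^ 6|) :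
    2 * (N ^ 3 * T ^ 3 * Z + N ^ 3 * S ^ 3 * Y)
      + r * (Z * (N * T)⁻¹ + Y * (N * S)⁻¹)
      + Z * (N * T)⁻¹ * b * Real.log ((N * T) ^ 2 *
          Real.log (max (T ^ 6 / Z ^ 2) (Z ^ 2 / T ^ 6)) + 1) ^ ((2 : ℝ) / 3)
      + Y * (N * S)⁻¹ * b * Real.log ((N * S) ^ 2 *
          Real.log (max (S ^ 6 / Y ^ 2) (Y ^ 2 / S ^ 6)) + 1) ^ ((2 : ℝ) / 3)
      ≤ 2 * N ^ 3 - r * N⁻¹ := by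
  have hN0 : 0 < N := by linarith
  have hT1 : T ≤ 1 := by
    rw [← pow_le_one_iff_of_nonneg hT.le (show 6 ≠ 0 by norm_num)]
    linarith [pow_pos hS 6]
  have hS1 : S ≤ 1 := by
    rw [← pow_le_one_iff_of_nonneg hS.le (show 6 ≠ 0 by norm_num)]
    linarith [pow_pos hT 6]
  have hZ1 : Z ≤ 1 := by nlinarith
  have hY1 : Y ≤ 1 := by nlinarith
  have hsq : r * (3 + N ^ 2 * |T ^ 3 - Z| + N ^ 2 * |S ^ 3 - Y|)
      + b * (2 + 9 * (N ^ 2 * |T ^ 3 - Z|) + 9 * (N ^ 2 * |S ^ 3 - Y|))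
      ≤ (N ^ 2 * |T ^ 3 - Z|) ^ 2 + (N ^ 2 * |S ^ 3 - Y|) ^ 2 := by
    rcases min_choice (T ^ 2) (S ^ 2) with hmin | hmin <;> rw [hmin] at h
    · exact linear_le_sq_add_sq_of_le hb.le hr.le
        (mul_le_dist_of_sq_mul_le hT hT1 hNT hN0 hZ hr.le h)
    · have hsymm : |Z ^ 2 - T ^ 6| = |Y ^ 2 - S ^ 6| := by
        rw [← abs_neg]
        congr 1
        linarith
      rw [hsymm] at h
      linarith [linear_le_sq_add_sq_of_le (v := N ^ 2 * |T ^ 3 - Z|) hb.le hr.le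
        (mul_le_dist_of_sq_mul_le hS hS1 hNS hN0 hY hr.le h)]
  have hmain : (N ^ 2 * |T ^ 3 - Z|) ^ 2 + (N ^ 2 * |S ^ 3 - Y|) ^ 2
      = N * (2 * N ^ 3 - 2 * (N ^ 3 * T ^ 3 * Z + N ^ 3 * S ^ 3 * Y)) := by
    rw [mul_pow, mul_pow, sq_abs, sq_abs]
    linear_combination N ^ 4 * hTS + N ^ 4 * hZY
  have hT_div := div_le_one_add_dist (Z := Z) hT hT1 hN hNT
  have hS_div := div_le_one_add_dist (Z := Y) hS hS1 hN hNS
  have hT_log := div_mul_log_rpow_le hT hT1 hN hNT hZ hZ1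
  have hS_log := div_mul_log_rpow_le hS hS1 hN hNS hY hY1
  set L₁ := Real.log ((N * T) ^ 2 *
    Real.log (max (T ^ 6 / Z ^ 2) (Z ^ 2 / T ^ 6)) + 1) ^ ((2 : ℝ) / 3)
  set L₂ := Real.log ((N * S) ^ 2 *
    Real.log (max (S ^ 6 / Y ^ 2) (Y ^ 2 / S ^ 6)) + 1) ^ ((2 : ℝ) / 3)
  have herr : r * (1 + Z / T + Y / S) + b * (Z / T * L₁ + Y / S * L₂)
      ≤ N * (2 * N ^ 3 - 2 * (N ^ 3 * T ^ 3 * Z + N ^ 3 * S ^ 3 * Y)) := by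
    rw [← hmain]
    refine le_trans ?_ hsq
    apply add_le_add
    · exact mul_le_mul_of_nonneg_left (by linarith) (by linarith)
    · exact mul_le_mul_of_nonneg_left (by linarith) hb.le
  have hdiv : N⁻¹ * (r * (1 + Z / T + Y / S) + b * (Z / T * L₁ + Y / S * L₂))
      ≤ 2 * N ^ 3 - 2 * (N ^ 3 * T ^ 3 * Z + N ^ 3 * S ^ 3 * Y) := by
    rwa [inv_mul_le_iff₀ hN0]
  have hexpand : N⁻¹ * (r * (1 + Z / T + Y / S) + b * (Z / T * L₁ + Y / S * L₂))
      = r * N⁻¹ + r * (Z * (N * T)⁻¹ + Y * (N * S)⁻¹)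
        + Z * (N * T)⁻¹ * b * L₁ + Y * (N * S)⁻¹ * b * L₂ := by
    rw [mul_inv, mul_inv]
    ring
  linarith

theorem exists_pos_pow_six_eq {x : ℝ} (hx : 0 < x) : ∃ y : ℝ, 0 < y ∧ x = y ^ 6 :=
  ⟨x ^ ((1 : ℝ) / 6), by positivity, by
    rw [← Real.rpow_natCast, ← Real.rpow_mul hx.le]
    norm_num⟩

theorem pow_six_rpow {x : ℝ} (hx : 0 < x) (p : ℝ) : (x ^ 6) ^ p = x ^ (6 * p) := by
  rw [← Real.rpow_natCast, ← Real.rpow_mul hx.le]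
  norm_num

theorem pow_six_rpow_third {x : ℝ} (hx : 0 < x) : (x ^ 6) ^ ((1 : ℝ) / 3) = x ^ 2 := by
  rw [pow_six_rpow hx, ← Real.rpow_natCast]
  norm_num

theorem pow_six_rpow_neg_third {x : ℝ} (hx : 0 < x) :
    (x ^ 6) ^ (-(1 : ℝ) / 3) = (x ^ 2)⁻¹ := by
  rw [neg_div, Real.rpow_neg (by positivity), pow_six_rpow_third hx]

theorem pow_six_rpow_neg_sixth {x : ℝ} (hx : 0 < x) : (x ^ 6) ^ (-(1 : ℝ) / 6) = x⁻¹ := by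
  rw [pow_six_rpow hx, ← Real.rpow_neg_one]
  norm_num

theorem sqrt_pow_six {x : ℝ} (hx : 0 < x) : Real.sqrt (x ^ 6) = x ^ 3 := by
  rw [show x ^ 6 = (x ^ 3) ^ 2 by ring, Real.sqrt_sq (by positivity)]


/-- **A deterministic inequality for rescaled melon sums.** For any fixed `b > 0` there
is `c > 0` such that for all `n ≥ 2`, all `t ∈ {1/n, …, (n−1)/n}`, all `r > 1` and all
`z ∈ [0, 1]` with `|z − t| ≥ c (min(t, 1−t))^{1/3} r² n^{−1/3}`, the sum of the
leading-order term `2(√(ntz) + √(n(1−t)(1−z)))` and the three error terms is at most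
`2√n − r n^{−1/6}`. -/
theorem melon_sum_inequality (b : ℝ) (hb : 0 < b) :
    ∃ c : ℝ, 0 < c ∧
      ∀ n : ℕ, 2 ≤ n →
      ∀ t : ℝ, (∃ j : ℕ, 1 ≤ j ∧ j ≤ n - 1 ∧ t = (j : ℝ) / (n : ℝ)) →
      ∀ r : ℝ, 1 < r →
      ∀ z : ℝ, z ∈ Set.Icc (0 : ℝ) 1 →
        c * (min t (1 - t)) ^ ((1 : ℝ) / 3) * r ^ 2 * (n : ℝ) ^ (-(1 : ℝ) / 3) ≤ |z - t| →
        2 * (Real.sqrt ((n : ℝ) * t * z) + Real.sqrt ((n : ℝ) * (1 - t) * (1 - z)))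
          + r * (Real.sqrt z * ((n : ℝ) * t) ^ (-(1 : ℝ) / 6)
              + Real.sqrt (1 - z) * ((n : ℝ) * (1 - t)) ^ (-(1 : ℝ) / 6))
          + Real.sqrt z * ((n : ℝ) * t) ^ (-(1 : ℝ) / 6) * b *
            Real.log (((n : ℝ) * t) ^ ((1 : ℝ) / 3) *
                Real.log (max (t / z) (z / t)) + 1) ^ ((2 : ℝ) / 3)
          + Real.sqrt (1 - z) * ((n : ℝ) * (1 - t)) ^ (-(1 : ℝ) / 6) * b *
            Real.log (((n : ℝ) * (1 - t)) ^ ((1 : ℝ) / 3) *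
                Real.log (max ((1 - t) / (1 - z)) ((1 - z) / (1 - t))) + 1) ^ ((2 : ℝ) / 3)
          ≤ 2 * Real.sqrt n - r * (n : ℝ) ^ (-(1 : ℝ) / 6) := by
  refine ⟨(18 * b + 5 + 1) ^ 2, by positivity, ?_⟩
  rintro n hn t ⟨j, hj1, hjn, rfl⟩ r hr z ⟨hz0, hz1⟩ h
  have hn1 : (1 : ℝ) ≤ n := by exact_mod_cast (by omega : 1 ≤ n)
  have hn0 : (0 : ℝ) < n := by linarith
  have hj1' : (1 : ℝ) ≤ j := by exact_mod_cast hj1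
  have hjn' : (j : ℝ) + 1 ≤ n := by exact_mod_cast (by omega : j + 1 ≤ n)
  obtain ⟨t, ht⟩ : ∃ t : ℝ, t = (j : ℝ) / n := ⟨_, rfl⟩
  have hnt : 1 ≤ (n : ℝ) * t := by rwa [ht, mul_div_cancel₀ _ hn0.ne']
  have hns : 1 ≤ (n : ℝ) * (1 - t) := by
    rw [ht, mul_sub, mul_div_cancel₀ _ hn0.ne']
    linarith
  rw [← ht] at h ⊢
  obtain ⟨s, hs⟩ : ∃ s : ℝ, s = 1 - t := ⟨_, rfl⟩
  obtain ⟨y, hy⟩ : ∃ y : ℝ, y = 1 - z := ⟨_, rfl⟩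
  rw [← hs] at hns
  rw [← hs] at h
  rw [← hs, ← hy]
  have ht0 : 0 < t := pos_of_mul_pos_right (by linarith) hn0.le
  have hs0 : 0 < s := pos_of_mul_pos_right (by linarith) hn0.le
  have hy0 : 0 ≤ y := by linarith
  have hst : t + s = 1 := by linarith
  have hyz : z + y = 1 := by linarith
  clear ht hs hy
  generalize (n : ℝ) = x at *
  obtain ⟨N, hN, rfl⟩ := exists_pos_pow_six_eq hn0
  obtain ⟨T, hT, rfl⟩ := exists_pos_pow_six_eq ht0
  obtain ⟨S, hS, rfl⟩ := exists_pos_pow_six_eq hs0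
  obtain ⟨Z, hZ, rfl⟩ : ∃ Z : ℝ, 0 ≤ Z ∧ z = Z ^ 2 :=
    ⟨Real.sqrt z, Real.sqrt_nonneg z, (Real.sq_sqrt hz0).symm⟩
  obtain ⟨Y, hY, rfl⟩ : ∃ Y : ℝ, 0 ≤ Y ∧ y = Y ^ 2 :=
    ⟨Real.sqrt y, Real.sqrt_nonneg y, (Real.sq_sqrt hy0).symm⟩
  have hNT : 0 < N * T := by positivity
  have hNS : 0 < N * S := by positivity
  rw [← mul_pow, one_le_pow_iff_of_nonneg (by positivity) (by norm_num)] at hnt hns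
  rw [one_le_pow_iff_of_nonneg hN.le (by norm_num)] at hn1
  have hmin : (min (T ^ 6) (S ^ 6)) ^ ((1 : ℝ) / 3) = min (T ^ 2) (S ^ 2) := by
    rw [← pow_six_rpow_third hT, ← pow_six_rpow_third hS]
    exact (Real.monotoneOn_rpow_Ici_of_exponent_nonneg (by norm_num)).map_min
      (Set.mem_Ici.2 (by positivity)) (Set.mem_Ici.2 (by positivity))
  rw [hmin, pow_six_rpow_neg_third hN] at h
  rw [← mul_pow, ← mul_pow, Real.sqrt_mul (pow_nonneg hNT.le 6),
    Real.sqrt_mul (pow_nonneg hNS.le 6),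
    sqrt_pow_six hNT, sqrt_pow_six hNS, sqrt_pow_six hN, Real.sqrt_sq hZ, Real.sqrt_sq hY,
    pow_six_rpow_neg_sixth hNT, pow_six_rpow_neg_sixth hNS, pow_six_rpow_neg_sixth hN,
    pow_six_rpow_third hNT, pow_six_rpow_third hNS, mul_pow N T 3, mul_pow N S 3]
  exact melon_sum_inequality_of_pow hb hr hn1 hT hS hst hnt hns hZ hY hyz h
end

section
/- Uniform parabolic upper bound for converging landscapes: Let f_n be a sequence of landscapes converging uniformly on compact sets to a proper landscape f, and fix b > 0 and set B = [−b,b]⁴ ∩ ℝ⁴↑. Then there exists a positive constant c_b such that for every ε ∈ (0,1) there exists n_ε ∈ ℕ such that for all n ≥ n_ε and all (x,t;y,t+s) ∈ B, f_n(x,t;y,t+s) ≤ c_b − (x−y)²/(s+ε). -/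
/-- The parameter space `ℝ⁴↑ = {(x, s, y, t) : s < t}` of pairs of space-time points. -/
def R4up : Set (ℝ × ℝ × ℝ × ℝ) := {p | p.2.1 < p.2.2.2}

/-- `f` is a landscape: it satisfies the metric composition law, with the maximum
attained. Here `f (x, s, y, t)` is read as `f(x, s; y, t)` for `s < t`. -/
def IsLandscape (f : ℝ × ℝ × ℝ × ℝ → ℝ) : Prop :=
  ∀ x y s r t : ℝ, s < r → r < t →
    IsGreatest (Set.range fun z => f (x, s, z, r) + f (z, r, y, t)) (f (x, s, y, t))

/-- `f` is a proper landscape: a continuous landscape with uniformly parabolic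
behaviour on bounded sets, compactly supported maximizers, and satisfying the
quadrangle inequality. -/
def IsProperLandscape (f : ℝ × ℝ × ℝ × ℝ → ℝ) : Prop :=
  IsLandscape f ∧
  ContinuousOn f R4up ∧
  (∀ b : ℝ, 0 < b → ∃ c : ℝ, ∀ x t y s : ℝ, 0 < s →
    |x| ≤ b → |t| ≤ b → |y| ≤ b → |t + s| ≤ b →
    |f (x, t, y, t + s) + (x - y) ^ 2 / s| ≤ c) ∧
  (∀ K : Set (ℝ × ℝ × ℝ × ℝ), K ⊆ R4up → IsCompact K →
    ∃ bK : ℝ, 0 < bK ∧ ∀ x r y t : ℝ, (x, r, y, t) ∈ K → ∀ s ∈ Set.Ioo r t, ∀ z : ℝ,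
      (∀ w : ℝ, f (x, r, w, s) + f (w, s, y, t) ≤ f (x, r, z, s) + f (z, s, y, t)) →
      |z| ≤ bK) ∧
  (∀ x x' y y' r t : ℝ, r < t → x ≤ x' → y ≤ y' →
    f (x, r, y', t) + f (x', r, y, t) ≤ f (x, r, y, t) + f (x', r, y', t))

/-- The length `∫ df ∘ π` of a path `π : [t, s] → ℝ` with respect to a landscape `f`:
the infimum over partitions `t = t₀ < t₁ < … < t_k = s` of the sum of the increments
of `f` along the path. -/
noncomputable def pathLength (f : ℝ × ℝ × ℝ × ℝ → ℝ) (π : ℝ → ℝ) (t s : ℝ) : ℝ :=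
  sInf { v : ℝ | ∃ (k : ℕ) (σ : ℕ → ℝ), 0 < k ∧ σ 0 = t ∧ σ k = s ∧
    (∀ i < k, σ i < σ (i + 1)) ∧
    v = ∑ i ∈ Finset.range k, f (π (σ i), σ i, π (σ (i + 1)), σ (i + 1)) }

/-- `π` is a geodesic from `(π t, t)` to `(π s, s)` in the landscape `f`: a continuous
path on `[t, s]` whose length equals `f (π t, t, π s, s)`. -/
def IsGeodesic (f : ℝ × ℝ × ℝ × ℝ → ℝ) (π : ℝ → ℝ) (t s : ℝ) : Prop :=
  ContinuousOn π (Set.Icc t s) ∧ pathLength f π t s = f (π t, t, π s, s)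

/-- The reverse triangle inequality for landscapes. -/
theorem IsLandscape.add_le {f : ℝ × ℝ × ℝ × ℝ → ℝ} (hf : IsLandscape f) {s r t : ℝ}
    (hsr : s < r) (hrt : r < t) (x z y : ℝ) :
    f (x, s, z, r) + f (z, r, y, t) ≤ f (x, s, y, t) :=
  (hf x y s r t hsr hrt).2 ⟨z, rfl⟩

/-- The part of `[-b, b]⁴` whose time increments are at least `δ` is compact. -/
theorem isCompact_box_of_le_time_increment (b δ : ℝ) :
    IsCompact {p : ℝ × ℝ × ℝ × ℝ |
      p ∈ Set.Icc (-b, -b, -b, -b) (b, b, b, b) ∧ p.2.1 + δ ≤ p.2.2.2} :=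
  isCompact_Icc.inter_right (isClosed_le
    (f := fun p : ℝ × ℝ × ℝ × ℝ => p.2.1 + δ) (g := fun p => p.2.2.2)
    (by fun_prop) (by fun_prop))

/-- **Uniform parabolic upper bound for converging landscapes.** If landscapes
`fseq n` converge uniformly on compact subsets of `ℝ⁴↑` to a proper landscape `f`,
then for every `b > 0` there is `c > 0` such that for every `ε ∈ (0, 1)` there is
`N` with `fseq n (x, t, y, t + s) ≤ c − (x − y)²/(s + ε)` for all `n ≥ N` and all
`(x, t, y, t + s) ∈ [−b, b]⁴ ∩ ℝ⁴↑`. -/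
theorem uniform_parabolic_bound
    (f : ℝ × ℝ × ℝ × ℝ → ℝ) (fseq : ℕ → ℝ × ℝ × ℝ × ℝ → ℝ)
    (hf : IsProperLandscape f) (hfn : ∀ n, IsLandscape (fseq n))
    (hconv : ∀ K : Set (ℝ × ℝ × ℝ × ℝ), K ⊆ R4up → IsCompact K →
      TendstoUniformlyOn fseq f Filter.atTop K)
    (b : ℝ) (hb : 0 < b) :
    ∃ c : ℝ, 0 < c ∧
      ∀ ε : ℝ, ε ∈ Set.Ioo (0 : ℝ) 1 →
        ∃ N : ℕ, ∀ n : ℕ, N ≤ n →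
          ∀ x t y s : ℝ, 0 < s → |x| ≤ b → |t| ≤ b → |y| ≤ b → |t + s| ≤ b →
            fseq n (x, t, y, t + s) ≤ c - (x - y) ^ 2 / (s + ε) := by
  obtain ⟨-, -, hpar, -, -⟩ := hf
  obtain ⟨C, hC⟩ := hpar (b + 1) (by linarith)
  have hC0 : 0 ≤ C := (abs_nonneg _).trans
    (hC 0 0 0 b hb (by simpa using by linarith) (by simpa using by linarith)
      (by simpa using by linarith) (by rw [zero_add, abs_of_pos hb]; linarith))
  refine ⟨3 * C + 3, by linarith, fun ε hε => ?_⟩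
  obtain ⟨δ, rfl⟩ : ∃ δ, ε = 2 * δ := ⟨ε / 2, by ring⟩
  obtain ⟨hδ0, hδ1⟩ := hε
  have hδ : 0 < δ := by linarith
  have hunif := hconv _ (fun p hp => by
      have := hp.2
      change p.2.1 < p.2.2.2
      linarith) (isCompact_box_of_le_time_increment (b + 1) δ)
  rw [Metric.tendstoUniformlyOn_iff] at hunif
  obtain ⟨N, hN⟩ := Filter.eventually_atTop.1 (hunif 1 one_pos)
  refine ⟨N, fun n hn x t y s hs hx ht hy hts => ?_⟩
  have close : ∀ x' t' y' s' : ℝ, δ ≤ s' → |x'| ≤ b + 1 → |t'| ≤ b + 1 → |y'| ≤ b + 1 →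
      |t' + s'| ≤ b + 1 →
      |fseq n (x', t', y', t' + s') + (x' - y') ^ 2 / s'| ≤ C + 1 := by
    intro x' t' y' s' hs' hx' ht' hy' hts'
    have h1 := hC x' t' y' s' (by linarith) hx' ht' hy' hts'
    have h2 := hN n hn (x', t', y', t' + s') (by
      rw [abs_le] at hx' ht' hy' hts'
      exact ⟨⟨⟨hx'.1, ht'.1, hy'.1, hts'.1⟩, ⟨hx'.2, ht'.2, hy'.2, hts'.2⟩⟩, by simpa using hs'⟩)
    rw [Real.dist_eq, abs_lt] at h2
    rw [abs_le] at h1 ⊢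
    constructor <;> linarith
  have hx1 : |x| ≤ b + 1 := by linarith
  have hy1 : |y| ≤ b + 1 := by linarith
  have ht1 : |t| ≤ b + 1 := by linarith
  have hts1 : |t + s| ≤ b + 1 := by linarith
  have htδ : |t - δ| ≤ b + 1 := by rw [abs_le] at ht ⊢; constructor <;> linarith
  have htsδ : |t + s + δ| ≤ b + 1 := by rw [abs_le] at hts ⊢; constructor <;> linarith
  have hleft := close x (t - δ) x δ le_rfl hx1 htδ hx1 (by simpa using ht1)
  have hright := close y (t + s) y δ le_rfl hy1 hts1 hy1 htsδ
  have hend : t - δ + (s + 2 * δ) = t + s + δ := by ring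
  have hlong := close x (t - δ) y (s + 2 * δ) (by linarith) hx1 htδ hy1 (by rwa [hend])
  rw [hend] at hlong
  rw [sub_add_cancel] at hleft
  simp only [sub_self, ne_eq, OfNat.ofNat_ne_zero, not_false_eq_true, zero_pow, zero_div,
    add_zero] at hleft hright
  have htri₁ := (hfn n).add_le (by linarith : t - δ < t) (by linarith : t < t + s + δ) x x y
  have htri₂ := (hfn n).add_le (by linarith : t < t + s) (by linarith : t + s < t + s + δ) x y y
  rw [abs_le] at hleft hright hlong
  linarith
end
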